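/- arXiv:2511.10717 — 3 statements merged into one kernel-verified Lean document; each statement's English description precedes it below -/
import Mathlib

section
/- For every integer t ≥ 3 there exists a finite simple graph G on exactly 8t vertices with exactly 15t edges such that G is 3-connected and for every vertex v of G the subgraph induced by the neighborhood N(v) contains a cycle. (Such a graph is obtained from the prism C_t □ K_2 by replacing each vertex with a copy of K_4, attaching the three former incident edges to three distinct vertices of that K_4.) -/
/-- An equivalence relation on `ZMod t` relating `i` to `i + 1` for all but at most one `i`
is total. -/
theorem ZMod.rel_of_rel_add_one {t : ℕ} [NeZero t] {P : ZMod t → ZMod t → Prop}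
    (hP : Equivalence P) (m : ZMod t) (h : ∀ i, i ≠ m → P i (i + 1)) (x y : ZMod t) : P x y := by
  have key : ∀ n : ℕ, n < t → P (m + 1) (m + 1 + n) := by
    intro n
    induction n with
    | zero => intro _; simpa using hP.refl (m + 1)
    | succ n ih =>
      intro hn
      have hne : m + 1 + (n : ZMod t) ≠ m := by
        intro he
        have h0 : ((n + 1 : ℕ) : ZMod t) = 0 := by
          push_cast
          linear_combination he
        rw [ZMod.natCast_eq_zero_iff] at h0
        exact absurd (Nat.le_of_dvd (Nat.succ_pos n) h0) (by omega)
      have := hP.trans (ih (by omega)) (h _ hne)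
      convert this using 1
      push_cast
      ring
  have all : ∀ x, P (m + 1) x := by
    intro x
    have := key (x - (m + 1)).val (ZMod.val_lt _)
    rwa [ZMod.natCast_zmod_val, add_sub_cancel] at this
  exact hP.trans (hP.symm (all x)) (all y)

/-- The `t`-prism is `3`-edge-connected. The edge set is indexed by `ZMod t × Option Bool`, where
`(i, none)` is the rung at `i` and `(i, some b)` joins `(i, b)` to `(i + 1, b)`; an equivalence
relation containing all edges outside a set `K` of at most two edges is total. -/
theorem prism_rel_of_card_le_two {t : ℕ} [NeZero t] (ht : 3 ≤ t)
    {Q : ZMod t × Bool → ZMod t × Bool → Prop} (hQ : Equivalence Q)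
    (K : Finset (ZMod t × Option Bool)) (hK : K.card ≤ 2)
    (rung : ∀ i, (i, none) ∉ K → Q (i, false) (i, true))
    (rim : ∀ i b, (i, some b) ∉ K → Q (i, b) (i + 1, b)) (x y : ZMod t × Bool) : Q x y := by
  have hQb (b : Bool) : Equivalence fun i j => Q (i, b) (j, b) :=
    ⟨fun _ => hQ.refl _, hQ.symm, hQ.trans⟩
  by_cases hcase : ∀ b, ∃ m, ∀ i, i ≠ m → (i, some b) ∉ K
  · have cyc (b : Bool) (i j : ZMod t) : Q (i, b) (j, b) := by
      obtain ⟨m, hm⟩ := hcase b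
      exact ZMod.rel_of_rel_add_one (hQb b) m (fun i hi => rim i b (hm i hi)) i j
    obtain ⟨i, hi⟩ : ∃ i : ZMod t, (i, none) ∉ K := by
      by_contra! hall
      have hle := Finset.card_le_card_of_injOn (s := (Finset.univ : Finset (ZMod t))) (t := K)
        (fun i => (i, none)) (fun i _ => hall i) (by intro a _ b _ hab; simpa using hab)
      rw [Finset.card_univ, ZMod.card] at hle
      omega
    have base : ∀ z, Q (i, false) z := by
      rintro ⟨j, b⟩
      cases b
      · exact cyc _ _ _
      · exact hQ.trans (rung i hi) (cyc _ _ _)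
    exact hQ.trans (hQ.symm (base x)) (base y)
  · push Not at hcase
    obtain ⟨b, hb⟩ := hcase
    obtain ⟨m₁, -, h₁⟩ := hb 0
    obtain ⟨m₂, hne, h₂⟩ := hb m₁
    have hKeq : {(m₁, some b), (m₂, some b)} = K := by
      apply Finset.eq_of_subset_of_card_le
      · intro z hz
        simp only [Finset.mem_insert, Finset.mem_singleton] at hz
        rcases hz with rfl | rfl <;> assumption
      · rw [Finset.card_pair (by simpa using hne.symm)]
        exact hK
    have rung_flip (i : ZMod t) (c : Bool) : Q (i, !b) (i, c) := by
      have h := rung i (by simp [← hKeq])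
      cases b <;> cases c <;> first | exact hQ.refl _ | exact h | exact hQ.symm h
    have cyc (i j : ZMod t) : Q (i, !b) (j, !b) :=
      ZMod.rel_of_rel_add_one (hQb (!b)) 0 (fun i _ => rim i _ (by simp [← hKeq])) i j
    have base : ∀ z, Q (0, !b) z := fun z => hQ.trans (cyc 0 z.1) (rung_flip z.1 z.2)
    exact hQ.trans (hQ.symm (base x)) (base y)

/-- The `t`-prism with every vertex replaced by a copy of `K₄`: in the copy at `(i, b)`, vertex `1`
is attached to the rung, and vertices `2` and `3` to the next and the previous copy. -/
def inflatedPrism (t : ℕ) [Fact (1 < t)] : SimpleGraph (ZMod t × Bool × Fin 4) where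
  Adj x y :=
    (x.1 = y.1 ∧ x.2.1 = y.2.1 ∧ x.2.2 ≠ y.2.2) ∨
    (x.1 = y.1 ∧ x.2.1 ≠ y.2.1 ∧ x.2.2 = 1 ∧ y.2.2 = 1) ∨
    (y.1 = x.1 + 1 ∧ x.2.1 = y.2.1 ∧ x.2.2 = 2 ∧ y.2.2 = 3) ∨
    (x.1 = y.1 + 1 ∧ x.2.1 = y.2.1 ∧ x.2.2 = 3 ∧ y.2.2 = 2)
  symm := ⟨by
    rintro x y (⟨h₁, h₂, h₃⟩ | ⟨h₁, h₂, h₃, h₄⟩ | ⟨h₁, h₂, h₃, h₄⟩ | ⟨h₁, h₂, h₃, h₄⟩)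
    · exact Or.inl ⟨h₁.symm, h₂.symm, h₃.symm⟩
    · exact Or.inr (Or.inl ⟨h₁.symm, h₂.symm, h₄, h₃⟩)
    · exact Or.inr (Or.inr (Or.inr ⟨h₁, h₂.symm, h₄, h₃⟩))
    · exact Or.inr (Or.inr (Or.inl ⟨h₁, h₂.symm, h₄, h₃⟩))⟩
  loopless := ⟨by
    rintro x (⟨-, -, h⟩ | ⟨-, h, -, -⟩ | ⟨-, -, h, h₂⟩ | ⟨-, -, h, h₂⟩)
    · exact h rfl
    · exact h rfl
    · exact absurd (h.symm.trans h₂) (by decide)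
    · exact absurd (h.symm.trans h₂) (by decide)⟩

namespace inflatedPrism

variable {t : ℕ} [Fact (1 < t)]

theorem adj_mk {i j : ZMod t} {b c : Bool} {k l : Fin 4} :
    (inflatedPrism t).Adj (i, b, k) (j, c, l) ↔
      (i = j ∧ b = c ∧ k ≠ l) ∨ (i = j ∧ b ≠ c ∧ k = 1 ∧ l = 1) ∨
      (j = i + 1 ∧ b = c ∧ k = 2 ∧ l = 3) ∨ (i = j + 1 ∧ b = c ∧ k = 3 ∧ l = 2) :=
  Iff.rfl

open Classical in
theorem degree_eq [NeZero t] (i : ZMod t) (b : Bool) (k : Fin 4) :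
    (inflatedPrism t).degree (i, b, k) = if k = 0 then 3 else 4 := by
  have hcell : ∀ s : Finset (ZMod t × Bool × Fin 4),
      (∀ z, (inflatedPrism t).Adj (i, b, k) z ↔ z ∈ s) →
      (inflatedPrism t).degree (i, b, k) = s.card := by
    intro s hs
    rw [← SimpleGraph.card_neighborFinset_eq_degree]
    congr 1
    ext z
    rw [SimpleGraph.mem_neighborFinset, hs]
  fin_cases k
  · rw [hcell {(i, b, 1), (i, b, 2), (i, b, 3)}]
    · simp
    · rintro ⟨j, c, l⟩
      fin_cases l <;> simp [adj_mk, eq_comm]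
  · rw [hcell {(i, b, 0), (i, b, 2), (i, b, 3), (i, !b, 1)}]
    · simp
    · rintro ⟨j, c, l⟩
      fin_cases l <;> cases b <;> cases c <;> simp [adj_mk, eq_comm]
  · rw [hcell {(i, b, 0), (i, b, 1), (i, b, 3), (i + 1, b, 3)}]
    · simp
    · rintro ⟨j, c, l⟩
      fin_cases l <;> cases b <;> cases c <;> simp [adj_mk, eq_comm]
  · rw [hcell {(i, b, 0), (i, b, 1), (i, b, 2), (i - 1, b, 2)}]
    · have hne : i ≠ i - 1 := by simp [eq_sub_iff_add_eq]
      simp [hne]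
    · rintro ⟨j, c, l⟩
      fin_cases l <;> cases b <;> cases c <;> simp [adj_mk, eq_comm, eq_sub_iff_add_eq]

theorem ncard_edgeSet [NeZero t] : (inflatedPrism t).edgeSet.ncard = 15 * t := by
  classical
  have h := (inflatedPrism t).sum_degrees_eq_twice_card_edges
  simp only [Fintype.sum_prod_type, degree_eq, Fin.sum_univ_four] at h
  simp [ZMod.card] at h
  rw [← SimpleGraph.coe_edgeFinset, Set.ncard_coe_finset]
  omega

theorem not_isAcyclic_induce_neighborSet (v : ZMod t × Bool × Fin 4) :
    ¬ ((inflatedPrism t).induce ((inflatedPrism t).neighborSet v)).IsAcyclic := by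
  obtain ⟨i, b, k⟩ := v
  have hk : ∀ k : Fin 4, k ≠ k + 1 ∧ k ≠ k + 2 ∧ k ≠ k + 3 ∧ k + 1 ≠ k + 2 ∧ k + 2 ≠ k + 3 ∧
    k + 3 ≠ k + 1 := by decide
  obtain ⟨h₁, h₂, h₃, h₁₂, h₂₃, h₃₁⟩ := hk k
  classical
  intro h
  let G' := (inflatedPrism t).induce ((inflatedPrism t).neighborSet (i, b, k))
  let x : (inflatedPrism t).neighborSet (i, b, k) := ⟨(i, b, k + 1), Or.inl ⟨rfl, rfl, h₁⟩⟩
  let y : (inflatedPrism t).neighborSet (i, b, k) := ⟨(i, b, k + 2), Or.inl ⟨rfl, rfl, h₂⟩⟩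
  let z : (inflatedPrism t).neighborSet (i, b, k) := ⟨(i, b, k + 3), Or.inl ⟨rfl, rfl, h₃⟩⟩
  have hxy : G'.Adj x y := Or.inl ⟨rfl, rfl, h₁₂⟩
  have hyz : G'.Adj y z := Or.inl ⟨rfl, rfl, h₂₃⟩
  have hzx : G'.Adj z x := Or.inl ⟨rfl, rfl, h₃₁⟩
  obtain ⟨u, w, hw, -⟩ := SimpleGraph.is3Clique_iff_exists_cycle_length_three.mp
    ⟨{x, y, z}, SimpleGraph.is3Clique_triple_iff.mpr ⟨hxy, hzx.symm, hyz⟩⟩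
  exact h w hw

/-- The edge of the prism at which a vertex is attached (an arbitrary one for the vertex `0` of
each copy of `K₄`). -/
def attachedEdge (x : ZMod t × Bool × Fin 4) : ZMod t × Option Bool :=
  if x.2.2 = 2 then (x.1, some x.2.1) else if x.2.2 = 3 then (x.1 - 1, some x.2.1) else (x.1, none)

theorem connected_induce_compl [NeZero t] (ht : 3 ≤ t) (S : Finset (ZMod t × Bool × Fin 4))
    (hS : S.card ≤ 2) : ((inflatedPrism t).induce ((S : Set _)ᶜ)).Connected := by
  have survivor (i : ZMod t) (b : Bool) : ∃ k, (i, b, k) ∉ S := by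
    by_contra! hall
    have hle := Finset.card_le_card_of_injOn (s := (Finset.univ : Finset (Fin 4))) (t := S)
      (fun k => (i, b, k)) (fun k _ => hall k) (by intro a _ b _ hab; simpa using hab)
    rw [Finset.card_univ, Fintype.card_fin] at hle
    omega
  let H := (inflatedPrism t).induce ((S : Set _)ᶜ)
  have cell (i : ZMod t) (b : Bool) (k l : Fin 4) (hk : (i, b, k) ∉ S) (hl : (i, b, l) ∉ S) :
      H.Reachable ⟨(i, b, k), hk⟩ ⟨(i, b, l), hl⟩ := by
    by_cases hkl : k = l
    · subst hkl
      exact SimpleGraph.Reachable.refl _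
    · exact SimpleGraph.Adj.reachable (Or.inl ⟨rfl, rfl, hkl⟩)
  let Q (x y : ZMod t × Bool) : Prop := ∀ k l, ∀ hk : (x.1, x.2, k) ∉ S,
    ∀ hl : (y.1, y.2, l) ∉ S, H.Reachable ⟨_, hk⟩ ⟨_, hl⟩
  have hQ : Equivalence Q := by
    refine ⟨fun x k l hk hl => cell _ _ _ _ hk hl, fun h k l hk hl => (h l k hl hk).symm, ?_⟩
    intro x y z h₁ h₂ k l hk hl
    obtain ⟨m, hm⟩ := survivor y.1 y.2
    exact (h₁ k m hk hm).trans (h₂ m l hm hl)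
  have link {i j : ZMod t} {b c : Bool} {k l : Fin 4} (hk : (i, b, k) ∉ S) (hl : (j, c, l) ∉ S)
      (hadj : (inflatedPrism t).Adj (i, b, k) (j, c, l)) : Q (i, b) (j, c) := by
    intro k' l' hk' hl'
    have hmid : H.Adj ⟨_, hk⟩ ⟨_, hl⟩ := hadj
    exact ((cell _ _ _ _ hk' hk).trans hmid.reachable).trans (cell _ _ _ _ hl hl')
  classical
  have notMem {x : ZMod t × Bool × Fin 4} {e : ZMod t × Option Bool} (he : attachedEdge x = e)
      (h : e ∉ S.image attachedEdge) : x ∉ S :=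
    fun hx => h (he ▸ Finset.mem_image_of_mem _ hx)
  have total := prism_rel_of_card_le_two ht hQ (S.image attachedEdge)
    (Finset.card_image_le.trans hS)
    (fun i hi => link (k := 1) (l := 1) (notMem (by simp [attachedEdge]) hi)
      (notMem (by simp [attachedEdge]) hi) (by simp [adj_mk]))
    (fun i b hi => link (k := 2) (l := 3) (notMem (by simp [attachedEdge]) hi)
      (notMem (by simp [attachedEdge]) hi) (by simp [adj_mk]))
  obtain ⟨k, hk⟩ := survivor 0 false
  have : Nonempty ↥((S : Set (ZMod t × Bool × Fin 4))ᶜ) := ⟨⟨_, hk⟩⟩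
  refine SimpleGraph.Connected.mk ?_
  rintro ⟨⟨i, b, k⟩, hx⟩ ⟨⟨j, c, l⟩, hy⟩
  exact total (i, b) (j, c) k l hx hy

end inflatedPrism

/-- For every `t ≥ 3` there is a `3`-connected graph on `8t` vertices with `15t` edges in which
the neighborhood of every vertex contains a cycle. -/
theorem stmt_1 (t : ℕ) (ht : 3 ≤ t) :
    ∃ (V : Type) (_ : Fintype V) (G : SimpleGraph V),
      Fintype.card V = 8 * t ∧
      G.edgeSet.ncard = 15 * t ∧
      4 ≤ Fintype.card V ∧
      (∀ S : Finset V, S.card ≤ 2 → (G.induce ((↑S : Set V)ᶜ)).Connected) ∧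
      (∀ v : V, ¬ (G.induce (G.neighborSet v)).IsAcyclic) := by
  have : NeZero t := ⟨by omega⟩
  have : Fact (1 < t) := ⟨by omega⟩
  have hcard : Fintype.card (ZMod t × Bool × Fin 4) = 8 * t := by
    simp only [Fintype.card_prod, ZMod.card, Fintype.card_bool, Fintype.card_fin]
    omega
  exact ⟨ZMod t × Bool × Fin 4, inferInstance, inflatedPrism t, hcard,
    inflatedPrism.ncard_edgeSet, by omega, inflatedPrism.connected_induce_compl ht,
    inflatedPrism.not_isAcyclic_induce_neighborSet⟩
end

section
/- Let G be a finite simple 3-connected graph such that for every vertex the subgraph induced by its neighborhood contains a cycle. Suppose u and v are distinct vertices, both of degree exactly 3, with N(u) = N(v). Then the graph G − u (the induced subgraph on V(G) \ {u}) is again 3-connected, and for every vertex w of G − u the subgraph of G − u induced by the neighborhood of w in G − u contains a cycle. -/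
/-- A graph on three vertices that contains a cycle is complete. -/
theorem SimpleGraph.adj_of_card_eq_three_of_not_isAcyclic {W : Type*} [Fintype W]
    (H : SimpleGraph W) (hcard : Fintype.card W = 3) (hH : ¬ H.IsAcyclic)
    {x y : W} (hxy : x ≠ y) : H.Adj x y := by
  classical
  simp only [SimpleGraph.IsAcyclic, not_forall, not_not] at hH
  obtain ⟨z, p, hp⟩ := hH
  have hle : p.length ≤ 3 := by
    have h := hp.support_nodup.length_le_card
    rw [List.length_tail, SimpleGraph.Walk.length_support, hcard] at h
    simpa using h
  obtain ⟨s, hs⟩ := (SimpleGraph.is3Clique_iff_exists_cycle_length_three (G := H)).2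
    ⟨z, p, hp, le_antisymm hle hp.three_le_length⟩
  have hsu : s = Finset.univ := by
    rw [← Finset.card_eq_iff_eq_univ, hs.card_eq, hcard]
  subst hsu
  exact hs.isClique (by simp) (by simp) hxy

/-- A graph containing a triangle is not acyclic. -/
theorem SimpleGraph.not_isAcyclic_of_triangle {W : Type*} (H : SimpleGraph W) {x y z : W}
    (hxy : H.Adj x y) (hxz : H.Adj x z) (hyz : H.Adj y z) : ¬ H.IsAcyclic := by
  classical
  intro h
  obtain ⟨_, p, hp, -⟩ := (SimpleGraph.is3Clique_iff_exists_cycle_length_three (G := H)).1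
    ⟨{x, y, z}, SimpleGraph.is3Clique_triple_iff.2 ⟨hxy, hxz, hyz⟩⟩
  exact h p hp

/-- A map that is surjective and sends adjacent vertices to equal or adjacent ones preserves
connectedness. -/
theorem SimpleGraph.Connected.of_surjective_of_eq_or_adj {A B : Type*} {G : SimpleGraph A}
    {H : SimpleGraph B} (hG : G.Connected) (f : A → B) (hf : Function.Surjective f)
    (hadj : ∀ x y, G.Adj x y → f x = f y ∨ H.Adj (f x) (f y)) : H.Connected := by
  have key : ∀ {x y : A}, G.Walk x y → H.Reachable (f x) (f y) := by
    intro x y p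
    induction p with
    | nil => exact SimpleGraph.Reachable.refl _
    | cons h _ ih =>
      rcases hadj _ _ h with he | ha
      · rwa [he]
      · exact ha.reachable.trans ih
  have : Nonempty B := hG.nonempty.map f
  refine SimpleGraph.Connected.mk fun x y => ?_
  obtain ⟨a, rfl⟩ := hf x
  obtain ⟨b, rfl⟩ := hf y
  exact key (hG.preconnected a b).some


/-- If `G` is `3`-connected, every vertex's induced neighborhood contains a cycle, and `u ≠ v`
both have degree `3` with `N(u) = N(v)`, then `G - u` is again `3`-connected and every vertex's
induced neighborhood in `G - u` contains a cycle. -/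
theorem stmt_4 {V : Type*} [Fintype V] [DecidableEq V] (G : SimpleGraph V)
    [DecidableRel G.Adj]
    (hcard : 4 ≤ Fintype.card V)
    (hconn : ∀ S : Finset V, S.card ≤ 2 → (G.induce ((↑S : Set V)ᶜ)).Connected)
    (hcyc : ∀ v : V, ¬ (G.induce (G.neighborSet v)).IsAcyclic)
    (u v : V) (huv : u ≠ v) (hu : G.degree u = 3) (hv : G.degree v = 3)
    (hN : G.neighborSet u = G.neighborSet v) :
    4 ≤ Fintype.card (({u}ᶜ : Set V)) ∧
    (∀ S : Finset (({u}ᶜ : Set V)), S.card ≤ 2 →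
      ((G.induce ({u}ᶜ : Set V)).induce ((↑S : Set ({u}ᶜ : Set V))ᶜ)).Connected) ∧
    (∀ w : ({u}ᶜ : Set V),
      ¬ ((G.induce ({u}ᶜ : Set V)).induce
          ((G.induce ({u}ᶜ : Set V)).neighborSet w)).IsAcyclic) := by
  have hclique : ∀ {x y : V}, G.Adj u x → G.Adj u y → x ≠ y → G.Adj x y := by
    intro x y hx hy hxy
    have h := SimpleGraph.adj_of_card_eq_three_of_not_isAcyclic (G.induce (G.neighborSet u))
      (by rw [G.card_neighborSet_eq_degree, hu]) (hcyc u)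
      (x := ⟨x, hx⟩) (y := ⟨y, hy⟩) (fun h => hxy (congrArg Subtype.val h))
    simpa using h
  have hNadj : ∀ x, G.Adj u x ↔ G.Adj v x := fun x => Set.ext_iff.1 hN x
  have huv' : ¬ G.Adj u v := fun h => G.loopless.irrefl v ((hNadj v).1 h)
  rw [← G.card_neighborFinset_eq_degree] at hu
  refine ⟨?_, ?_, ?_⟩
  · have h5 : (insert u (insert v (G.neighborFinset u))).card = 5 := by
      rw [Finset.card_insert_of_notMem (by simp [huv]),
        Finset.card_insert_of_notMem (by simpa using huv'), hu]
    have h5' := Finset.card_le_univ (insert u (insert v (G.neighborFinset u)))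
    rw [Fintype.card_compl_set]
    simp only [Set.card_singleton]
    omega
  · intro S hS
    have hcardT : (S.map (Function.Embedding.subtype _)).card ≤ 2 := by simpa using hS
    obtain ⟨a, hau, haS⟩ := Finset.exists_mem_notMem_of_card_lt_card
      (s := S.map (Function.Embedding.subtype _)) (t := G.neighborFinset u) (by omega)
    have hua : G.Adj u a := by simpa using hau
    have hmem : ∀ {x : V} (hxu : x ≠ u), x ∉ S.map (Function.Embedding.subtype _) →
        (⟨x, hxu⟩ : (({u}ᶜ : Set V))) ∈ ((↑S : Set ({u}ᶜ : Set V))ᶜ) := by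
      intro x hxu hx hxS
      exact hx (Finset.mem_map.2 ⟨⟨x, hxu⟩, hxS, rfl⟩)
    refine (hconn _ hcardT).of_surjective_of_eq_or_adj
      (fun x => if hx : x.1 = u then ⟨⟨a, hua.ne'⟩, hmem hua.ne' haS⟩
        else ⟨⟨x.1, hx⟩, hmem hx x.2⟩) ?_ ?_
    · rintro ⟨⟨x, hxu⟩, hxS⟩
      have hxu' : x ≠ u := hxu
      refine ⟨⟨x, fun hx => ?_⟩, by simp [hxu']⟩
      obtain ⟨y, hyS, rfl⟩ := Finset.mem_map.1 hx
      exact hxS hyS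
    · rintro ⟨x, hx⟩ ⟨y, hy⟩ hxy
      have hxy' : G.Adj x y := hxy
      by_cases h1 : x = u <;> by_cases h2 : y = u
      · simp [h1, h2]
      · subst h1
        by_cases h : a = y
        · simp [h2, h]
        · right
          simpa [h2] using hclique hua hxy' h
      · subst h2
        by_cases h : x = a
        · simp [h]
        · right
          simpa [h1] using hclique hxy'.symm hua h
      · right
        simpa [h1, h2] using hxy'
  · rintro ⟨w, hwu⟩
    by_cases hw : G.Adj u w
    · have hcardw : ((G.neighborFinset u).erase w).card = 2 := by
        rw [Finset.card_erase_of_mem (by simpa using hw), hu]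
      obtain ⟨b, c, hbc, hE⟩ := Finset.card_eq_two.1 hcardw
      have hb : b ∈ (G.neighborFinset u).erase w := by simp [hE]
      have hc : c ∈ (G.neighborFinset u).erase w := by simp [hE]
      simp only [Finset.mem_erase, SimpleGraph.mem_neighborFinset] at hb hc
      exact SimpleGraph.not_isAcyclic_of_triangle _
        (x := ⟨⟨v, huv.symm⟩, ((hNadj w).1 hw).symm⟩)
        (y := ⟨⟨b, hb.2.ne'⟩, hclique hw hb.2 hb.1.symm⟩)
        (z := ⟨⟨c, hc.2.ne'⟩, hclique hw hc.2 hc.1.symm⟩)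
        ((hNadj b).1 hb.2) ((hNadj c).1 hc.2) (hclique hb.2 hc.2 hbc)
    · intro hac
      have hne : ∀ x : G.neighborSet w, x.1 ≠ u := by
        rintro ⟨x, hx⟩ rfl
        exact hw (SimpleGraph.Adj.symm hx)
      refine hcyc w (hac.comap ⟨fun x => ⟨⟨x.1, hne x⟩, x.2⟩, fun {x y} h => h⟩ ?_)
      intro x y hxy
      exact Subtype.ext (congrArg (fun z => z.1.1) hxy)
end

section
/- Let G be a finite simple 3-connected graph such that for every vertex the subgraph induced by its neighborhood contains a cycle, and assume additionally that no two distinct vertices of degree 3 have equal neighborhoods. Then every vertex v of degree at least 4 has at least 3 neighbors of degree at least 4; equivalently, deg(v) ≥ 3 + |N(v) ∩ V_3|, where V_3 is the set of vertices of degree exactly 3. -/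
/-- A non-acyclic graph on at most three vertices is complete. -/
theorem SimpleGraph.adj_of_not_isAcyclic_of_card_le_three {V : Type*} [Fintype V] [DecidableEq V]
    {G : SimpleGraph V} (hG : ¬ G.IsAcyclic) (hcard : Fintype.card V ≤ 3) {a b : V}
    (hab : a ≠ b) : G.Adj a b := by
  simp only [SimpleGraph.IsAcyclic, not_forall, not_not] at hG
  obtain ⟨u, c, hc⟩ := hG
  have hlen : c.support.tail.length ≤ 3 := hc.support_nodup.length_le_card.trans hcard
  have hthree := hc.three_le_length
  match c with
  | .nil => simp at hthree
  | .cons _ .nil => simp at hthree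
  | .cons _ (.cons _ .nil) => simp at hthree
  | .cons (v := x) hux (.cons (v := y) hxy (.cons hyu .nil)) =>
    have huniv : ({u, x, y} : Finset V) = Finset.univ := by
      apply Finset.eq_univ_of_card
      have hle := Finset.card_le_univ ({u, x, y} : Finset V)
      rw [Finset.card_eq_three.mpr ⟨u, x, y, hux.ne, hyu.ne', hxy.ne, rfl⟩] at hle ⊢
      omega
    have ha : a ∈ ({u, x, y} : Finset V) := huniv ▸ Finset.mem_univ a
    have hb : b ∈ ({u, x, y} : Finset V) := huniv ▸ Finset.mem_univ b
    simp only [Finset.mem_insert, Finset.mem_singleton] at ha hb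
    have := hux.symm
    have := hxy.symm
    have := hyu.symm
    rcases ha with rfl | rfl | rfl <;> rcases hb with rfl | rfl | rfl <;>
      first | assumption | exact absurd rfl hab
  | .cons _ (.cons _ (.cons _ (.cons _ _))) =>
    simp at hlen
    omega

/-- If the neighborhood of a vertex of degree `3` induces a graph with a cycle, then it is a
clique. -/
theorem SimpleGraph.isClique_neighborSet_of_degree_eq_three {V : Type*} [Fintype V]
    [DecidableEq V] {G : SimpleGraph V} [DecidableRel G.Adj] {x : V} (hx : G.degree x = 3)
    (hcyc : ¬ (G.induce (G.neighborSet x)).IsAcyclic) : G.IsClique (G.neighborSet x) := by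
  intro a ha b hb hab
  have hcard : Fintype.card (G.neighborSet x) ≤ 3 := by
    rw [G.card_neighborSet_eq_degree, hx]
  exact SimpleGraph.adj_of_not_isAcyclic_of_card_le_three hcyc hcard
    (a := ⟨a, ha⟩) (b := ⟨b, hb⟩) (by simpa using hab)

/-- A preconnected graph has no proper nonempty set of vertices closed under adjacency. -/
theorem SimpleGraph.Preconnected.mem_of_adj_closed {V : Type*} {G : SimpleGraph V}
    (hG : G.Preconnected) {S : Set V} (hS : ∀ a b, a ∈ S → G.Adj a b → b ∈ S) {x : V}
    (hx : x ∈ S) (w : V) : w ∈ S := by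
  obtain ⟨p⟩ := hG x w
  induction p with
  | nil => exact hx
  | cons h _ ih => exact ih (hS _ _ hx h)

/-- In a `3`-connected graph whose neighborhoods all contain a cycle, two neighbors of degree `3`
of a vertex of degree at least `4` are never adjacent. -/
theorem SimpleGraph.not_adj_of_degree_eq_three {V : Type*} [Fintype V] [DecidableEq V]
    {G : SimpleGraph V} [DecidableRel G.Adj]
    (hconn : ∀ S : Finset V, S.card ≤ 2 → (G.induce ((↑S : Set V)ᶜ)).Connected)
    (hcyc : ∀ v : V, ¬ (G.induce (G.neighborSet v)).IsAcyclic)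
    {v x y : V} (hv : 4 ≤ G.degree v) (hvx : G.Adj v x) (hvy : G.Adj v y)
    (hx : G.degree x = 3) (hy : G.degree y = 3) : ¬ G.Adj x y := by
  intro hxy
  have hclique := G.isClique_neighborSet_of_degree_eq_three hx (hcyc x)
  obtain ⟨z, hz, hzn⟩ : ∃ z ∈ G.neighborFinset x, z ∉ ({v, y} : Finset V) := by
    apply Finset.exists_mem_notMem_of_card_lt_card
    rw [G.card_neighborFinset_eq_degree, hx]
    exact Finset.card_le_two.trans_lt (by norm_num)
  simp only [SimpleGraph.mem_neighborFinset, Finset.mem_insert, Finset.mem_singleton,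
    not_or] at hz hzn
  have hyz : G.Adj y z := hclique hxy hz (Ne.symm hzn.2)
  have hNx : ({v, y, z} : Finset V) = G.neighborFinset x := by
    apply Finset.eq_of_subset_of_card_le
    · intro w
      simp only [Finset.mem_insert, Finset.mem_singleton, SimpleGraph.mem_neighborFinset]
      rintro (rfl | rfl | rfl)
      exacts [hvx.symm, hxy, hz]
    · rw [G.card_neighborFinset_eq_degree, hx,
        Finset.card_eq_three.mpr ⟨v, y, z, hvy.ne, Ne.symm hzn.1, hyz.ne, rfl⟩]
  have hNy : ({v, x, z} : Finset V) = G.neighborFinset y := by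
    apply Finset.eq_of_subset_of_card_le
    · intro w
      simp only [Finset.mem_insert, Finset.mem_singleton, SimpleGraph.mem_neighborFinset]
      rintro (rfl | rfl | rfl)
      exacts [hvy.symm, hxy.symm, hyz]
    · rw [G.card_neighborFinset_eq_degree, hy,
        Finset.card_eq_three.mpr ⟨v, x, z, hvx.ne, Ne.symm hzn.1, hz.ne, rfl⟩]
  obtain ⟨w, hw, hwn⟩ : ∃ w ∈ G.neighborFinset v, w ∉ ({x, y, z} : Finset V) := by
    apply Finset.exists_mem_notMem_of_card_lt_card
    rw [G.card_neighborFinset_eq_degree]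
    exact Finset.card_le_three.trans_lt hv
  simp only [SimpleGraph.mem_neighborFinset, Finset.mem_insert, Finset.mem_singleton,
    not_or] at hw hwn
  have hpre := (hconn {v, z} Finset.card_le_two).preconnected
  have hmem := hpre.mem_of_adj_closed (S := {a | a.1 = x ∨ a.1 = y})
    (x := ⟨x, by simp [hvx.ne', hz.ne]⟩) ?_ (Or.inl rfl)
    ⟨w, by simp [hw.ne', hwn.2.2]⟩
  · exact hmem.elim hwn.1 hwn.2.1
  · rintro ⟨a, ha⟩ ⟨b, hb⟩ hS hab
    simp only [Finset.coe_insert, Finset.coe_singleton, Set.mem_compl_iff, Set.mem_insert_iff,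
      Set.mem_singleton_iff, not_or] at hb
    simp only [SimpleGraph.comap_adj, Function.Embedding.subtype_apply] at hab
    rcases hS with h | h
    · have hbN : b ∈ ({v, y, z} : Finset V) := by
        rw [hNx, SimpleGraph.mem_neighborFinset]
        exact h ▸ hab
      simp only [Finset.mem_insert, Finset.mem_singleton, hb, or_false, false_or] at hbN
      exact Or.inr hbN
    · have hbN : b ∈ ({v, x, z} : Finset V) := by
        rw [hNy, SimpleGraph.mem_neighborFinset]
        exact h ▸ hab
      simp only [Finset.mem_insert, Finset.mem_singleton, hb, or_false, false_or] at hbN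
      exact Or.inl hbN


/-- In a `3`-connected graph where every vertex's induced neighborhood contains a cycle and no two
distinct vertices of degree `3` have equal neighborhoods, every vertex `v` of degree at least `4`
satisfies `deg(v) ≥ 3 + |N(v) ∩ V₃|`. -/
theorem stmt_5 {V : Type*} [Fintype V] [DecidableEq V] (G : SimpleGraph V)
    [DecidableRel G.Adj]
    (hcard : 4 ≤ Fintype.card V)
    (hconn : ∀ S : Finset V, S.card ≤ 2 → (G.induce ((↑S : Set V)ᶜ)).Connected)
    (hcyc : ∀ v : V, ¬ (G.induce (G.neighborSet v)).IsAcyclic)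
    (hdist : ∀ u v : V, u ≠ v → G.degree u = 3 → G.degree v = 3 →
      G.neighborSet u ≠ G.neighborSet v) :
    ∀ v : V, 4 ≤ G.degree v →
      3 + ((G.neighborFinset v).filter fun x => G.degree x = 3).card ≤ G.degree v := by
  intro v hv
  by_contra! hlt
  set A := (G.neighborFinset v).filter fun x => G.degree x = 3
  set B := (G.neighborFinset v).filter fun x => ¬ G.degree x = 3
  have hAB : A.card + B.card = G.degree v := by
    rw [← G.card_neighborFinset_eq_degree]
    exact Finset.card_filter_add_card_filter_not _
  have hN : ∀ x ∈ A, G.neighborFinset x = insert v B := by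
    intro x hxA
    obtain ⟨hvx, hx⟩ := Finset.mem_filter.mp hxA
    rw [SimpleGraph.mem_neighborFinset] at hvx
    apply Finset.eq_of_subset_of_card_le
    · intro y hxy
      rw [SimpleGraph.mem_neighborFinset] at hxy
      by_cases hyv : y = v
      · exact hyv ▸ Finset.mem_insert_self _ _
      have hvy : G.Adj v y := G.isClique_neighborSet_of_degree_eq_three hx (hcyc x) hvx.symm hxy
        (Ne.symm hyv)
      refine Finset.mem_insert_of_mem (Finset.mem_filter.mpr
        ⟨(G.mem_neighborFinset v y).mpr hvy, fun hy => ?_⟩)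
      exact G.not_adj_of_degree_eq_three hconn hcyc hv hvx hvy hx hy hxy
    · rw [G.card_neighborFinset_eq_degree, hx]
      exact (Finset.card_insert_le v B).trans (by omega)
  obtain ⟨x, hx, y, hy, hxy⟩ := Finset.one_lt_card.mp (show 1 < A.card by omega)
  refine hdist x y hxy (Finset.mem_filter.mp hx).2 (Finset.mem_filter.mp hy).2 ?_
  rw [← G.coe_neighborFinset x, ← G.coe_neighborFinset y, hN x hx, hN y hy]
end
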